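/- Let θ : ℝ × ℝ^d → ℝ^d be a continuously differentiable, compactly supported time-dependent velocity field, let T be its flow, and assume T is twice continuously differentiable jointly in (t, X). Let Ω ⊆ ℝ^d be a bounded measurable set, let N ≥ 1, ε > 0, z ∈ ℝ^N, and let c₁, …, c_N, s₁, …, s_N, φ, ψ : ℝ^d → ℝ be continuously differentiable with compact support. For small t set J_t(x) := det(D_X T_t(x)) and A(t, x) := J_t(x) (D_X T_t(x))⁻¹ (D_X T_t(x))⁻ᵀ, and define L̃(t) := Σ_{i=1}^N ∫_Ω [ −z_i c_i J_t + ⟨A(t)∇c_i, ∇s_i⟩ + z_i c_i ⟨A(t)∇φ, ∇s_i⟩ ] dx + ∫_Ω [ ε ⟨A(t)∇φ, ∇ψ⟩ − Σ_{i=1}^N z_i c_i ψ J_t ] dx. Then L̃ is differentiable at t = 0 with L̃'(0) = ∫_Ω [ (−Σ_{i=1}^N z_i c_i ψ − Σ_{i=1}^N z_i c_i) (div θ)(0, ·) + Σ_{i=1}^N ⟨M(θ)∇c_i, ∇s_i⟩ + Σ_{i=1}^N z_i c_i ⟨M(θ)∇φ, ∇s_i⟩ + ε ⟨M(θ)∇φ,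 ∇ψ⟩ ] dx, where M(θ)(x) := (div θ)(0, x) Id − Dθ(0, x) − Dθ(0, x)^T, Dθ(0, x) being the spatial Fréchet derivative of θ(0, ·) at x and (div θ)(0, x) its trace. -/

import Mathlib

open MeasureTheory
open scoped RealInnerProductSpace

/-- `Euc d` is the Euclidean space `ℝ^d`. -/
abbrev Euc (d : ℕ) := EuclideanSpace ℝ (Fin d)

/-- The Jacobian determinant `J_t(x) = det(D_X T_t(x))`. -/
noncomputable def flowJacDet {d : ℕ} (T : ℝ → Euc d → Euc d) (t : ℝ) (x : Euc d) : ℝ :=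
  LinearMap.det ((fderiv ℝ (T t) x).toLinearMap)

/-- The shape-calculus matrix `A(t, x) = J_t(x) (D_X T_t(x))⁻¹ (D_X T_t(x))⁻ᵀ`. -/
noncomputable def shapeMatrixA {d : ℕ} (T : ℝ → Euc d → Euc d) (t : ℝ) (x : Euc d) :
    Euc d →L[ℝ] Euc d :=
  flowJacDet T t x •
    ((fderiv ℝ (T t) x).inverse.comp
      (ContinuousLinearMap.adjoint ((fderiv ℝ (T t) x).inverse)))

/-- The divergence `(div θ)(0, x)`: the trace of the spatial Fréchet derivative of `θ(0, ·)`. -/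
noncomputable def divTheta0 {d : ℕ} (θ : ℝ × Euc d → Euc d) (x : Euc d) : ℝ :=
  LinearMap.trace ℝ (Euc d) ((fderiv ℝ (fun y => θ (0, y)) x).toLinearMap)

/-- The matrix `M(θ)(x) = (div θ)(0, x) Id − Dθ(0, x) − Dθ(0, x)ᵀ`. -/
noncomputable def shapeMatrixM {d : ℕ} (θ : ℝ × Euc d → Euc d) (x : Euc d) :
    Euc d →L[ℝ] Euc d :=
  divTheta0 θ x • ContinuousLinearMap.id ℝ (Euc d)
    - fderiv ℝ (fun y => θ (0, y)) x
    - ContinuousLinearMap.adjoint (fderiv ℝ (fun y => θ (0, y)) x)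

/-- Differentiation under the integral sign over a bounded set, for an integrand which is jointly
continuous, with jointly continuous time derivative, near the initial time slice. -/
theorem hasDerivAt_setIntegral_of_continuousOn {E : Type*} [MetricSpace E] [ProperSpace E]
    [MeasurableSpace E] [BorelSpace E] (μ : Measure E) [IsFiniteMeasureOnCompacts μ]
    {Ω : Set E} (hb : Bornology.IsBounded Ω) (hm : MeasurableSet Ω)
    {U : Set (ℝ × E)} (hU : IsOpen U) {t₀ : ℝ} (h0 : ∀ x, (t₀, x) ∈ U) {f f' : ℝ → E → ℝ}
    (hf : ContinuousOn (fun p : ℝ × E => f p.1 p.2) U)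
    (hf' : ContinuousOn (fun p : ℝ × E => f' p.1 p.2) U)
    (hd : ∀ p ∈ U, HasDerivAt (fun t => f t p.2) (f' p.1 p.2) p.1) :
    IntegrableOn (f' t₀) Ω μ ∧
      HasDerivAt (fun t => ∫ x in Ω, f t x ∂μ) (∫ x in Ω, f' t₀ x ∂μ) t₀ := by
  have hK : IsCompact (closure Ω) := hb.isCompact_closure
  obtain ⟨V, W, hV, -, htV, hKW, hVW⟩ :=
    generalized_tube_lemma (isCompact_singleton (x := t₀)) hK hU (by
      rintro ⟨t, x⟩ ⟨rfl, -⟩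
      exact h0 x)
  obtain ⟨δ, hδ, hball⟩ := Metric.nhds_basis_closedBall.mem_iff.1
    (hV.mem_nhds (htV rfl))
  have hsub : Metric.closedBall t₀ δ ×ˢ closure Ω ⊆ U :=
    (Set.prod_mono hball hKW).trans hVW
  obtain ⟨C, hC⟩ := ((isCompact_closedBall t₀ δ).prod hK).exists_bound_of_continuousOn
    (hf'.mono hsub)
  have slice : ∀ g : ℝ → E → ℝ, ContinuousOn (fun p : ℝ × E => g p.1 p.2) U →
      ∀ t ∈ Metric.closedBall t₀ δ, ContinuousOn (g t) (closure Ω) := by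
    intro g hg t ht
    exact hg.comp (f := fun x => (t, x)) (by fun_prop) fun x hx => hsub ⟨ht, hx⟩
  have hball_mem : Metric.closedBall t₀ δ ∈ nhds t₀ := Metric.closedBall_mem_nhds t₀ hδ
  have ht₀ : t₀ ∈ Metric.closedBall t₀ δ := Metric.mem_closedBall_self hδ.le
  refine hasDerivAt_integral_of_dominated_loc_of_deriv_le (bound := fun _ => C)
    hball_mem ?_ ?_ ?_ ?_ ?_ ?_
  · filter_upwards [hball_mem] with t ht
    exact ((slice f hf t ht).mono subset_closure).aestronglyMeasurable hm
  · exact ((slice f hf t₀ ht₀).integrableOn_compact hK).mono_set subset_closure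
  · exact ((slice f' hf' t₀ ht₀).mono subset_closure).aestronglyMeasurable hm
  · filter_upwards [ae_restrict_mem hm] with x hx t ht
    exact hC (t, x) ⟨ht, subset_closure hx⟩
  · exact (continuousOn_const.integrableOn_compact hK).mono_set subset_closure
  · filter_upwards [ae_restrict_mem hm] with x hx t ht
    exact hd (t, x) (hsub ⟨ht, subset_closure hx⟩)

section Determinant

variable {E : Type*} [NormedAddCommGroup E] [NormedSpace ℝ E] [FiniteDimensional ℝ E]

theorem contDiff_linearMap_det {n : WithTop ℕ∞} :
    ContDiff ℝ n (fun L : E →L[ℝ] E => LinearMap.det L.toLinearMap) := by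
  let b := Module.finBasis ℝ E
  have hentry : ∀ i j, ContDiff ℝ n
      (fun L : E →L[ℝ] E => LinearMap.toMatrix b b L.toLinearMap i j) := by
    intro i j
    simp only [LinearMap.toMatrix_apply, ContinuousLinearMap.coe_coe]
    exact ((b.coord i).toContinuousLinearMap.comp
      (ContinuousLinearMap.apply ℝ E (b j))).contDiff
  simp only [← LinearMap.det_toMatrix b, Matrix.det_apply']
  exact ContDiff.sum fun σ _ => contDiff_const.mul (contDiff_prod fun i _ => hentry _ _)

theorem fderiv_linearMap_det_id (M : E →L[ℝ] E) :
    fderiv ℝ (fun L : E →L[ℝ] E => LinearMap.det L.toLinearMap) (ContinuousLinearMap.id ℝ E) M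
      = LinearMap.trace ℝ E M.toLinearMap := by
  let b := Module.finBasis ℝ E
  let A := LinearMap.toMatrix b b M.toLinearMap
  have hline : HasDerivAt (fun r : ℝ => ContinuousLinearMap.id ℝ E + r • M) M 0 := by
    simpa using ((hasDerivAt_id (0 : ℝ)).smul_const M).const_add (ContinuousLinearMap.id ℝ E)
  have hdet := (contDiff_linearMap_det (E := E) (n := 1)).differentiable one_ne_zero
    |>.differentiableAt (x := ContinuousLinearMap.id ℝ E) |>.hasFDerivAt
  have h1 := HasFDerivAt.comp_hasDerivAt_of_eq (0 : ℝ) hdet hline (by simp)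
  let q := ((1 + (Polynomial.X : Polynomial ℝ) • A.map Polynomial.C).det.divX).divX
  have h2 : HasDerivAt (fun r : ℝ => 1 + A.trace * r + q.eval r * r ^ 2) A.trace 0 := by
    have := (((hasDerivAt_id (0 : ℝ)).const_mul A.trace).const_add 1).add
      ((q.hasDerivAt 0).mul ((hasDerivAt_id (0 : ℝ)).pow 2))
    refine (this.congr_deriv (by simp)).congr_of_eventuallyEq (.of_forall fun r => ?_)
    simp
  have heq : (fun L : E →L[ℝ] E => LinearMap.det L.toLinearMap) ∘
      (fun r : ℝ => ContinuousLinearMap.id ℝ E + r • M)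
      = fun r : ℝ => 1 + A.trace * r + q.eval r * r ^ 2 := by
    funext r
    rw [← Matrix.det_one_add_smul r A]
    have hmat : LinearMap.toMatrix b b (ContinuousLinearMap.id ℝ E + r • M).toLinearMap
        = 1 + r • A := by
      rw [ContinuousLinearMap.toLinearMap_add, ContinuousLinearMap.toLinearMap_smul, map_add,
        map_smul, ContinuousLinearMap.coe_id, LinearMap.toMatrix_id]
    rw [Function.comp_apply, ← LinearMap.det_toMatrix b, hmat]
  rw [heq] at h1
  rw [h1.unique h2, LinearMap.trace_eq_matrix_trace ℝ b]

end Determinant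

section ShapeTransform

variable {E : Type*} [NormedAddCommGroup E] [InnerProductSpace ℝ E] [FiniteDimensional ℝ E]

/-- The map `L ↦ det(L) L⁻¹ L⁻ᵀ`. -/
noncomputable def shapeTransform (L : E →L[ℝ] E) : E →L[ℝ] E :=
  LinearMap.det L.toLinearMap • (L.inverse.comp (ContinuousLinearMap.adjoint L.inverse))

theorem contDiffAt_shapeTransform {n : WithTop ℕ∞} {L : E →L[ℝ] E} (hL : IsUnit L) :
    ContDiffAt ℝ n shapeTransform L := by
  have hinv : ContDiffAt ℝ n (ContinuousLinearMap.inverse : (E →L[ℝ] E) → E →L[ℝ] E) L := by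
    rw [← ContinuousLinearMap.ringInverse_eq_inverse]
    obtain ⟨u, rfl⟩ := hL
    exact contDiffAt_ringInverse ℝ u
  have hadj : ContDiffAt ℝ n
      (fun L : E →L[ℝ] E => ContinuousLinearMap.adjoint L.inverse) L :=
    (starL' ℝ (A := E →L[ℝ] E)).contDiff.contDiffAt.comp L hinv
  exact contDiff_linearMap_det.contDiffAt.smul (hinv.clm_comp hadj)

theorem hasDerivAt_shapeTransform {D : ℝ → E →L[ℝ] E} {D' : E →L[ℝ] E} {t : ℝ}
    (hD : HasDerivAt D D' t) (hid : D t = ContinuousLinearMap.id ℝ E) :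
    HasDerivAt (fun r => shapeTransform (D r))
      (LinearMap.trace ℝ E D'.toLinearMap • ContinuousLinearMap.id ℝ E - D'
        - ContinuousLinearMap.adjoint D') t := by
  have hdet : HasDerivAt (fun r => LinearMap.det (D r).toLinearMap)
      (LinearMap.trace ℝ E D'.toLinearMap) t := by
    rw [← fderiv_linearMap_det_id]
    exact HasFDerivAt.comp_hasDerivAt_of_eq t
      ((contDiff_linearMap_det (n := 1)).differentiable one_ne_zero _).hasFDerivAt hD hid.symm
  have hinv : HasDerivAt (fun r => (D r).inverse) (-D') t := by
    rw [← ContinuousLinearMap.ringInverse_eq_inverse]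
    have h := HasFDerivAt.comp_hasDerivAt_of_eq t
      (hasFDerivAt_ringInverse (𝕜 := ℝ) (1 : (E →L[ℝ] E)ˣ)) hD hid.symm
    simpa [Function.comp_def] using h
  have hadj : HasDerivAt (fun r => ContinuousLinearMap.adjoint (D r).inverse)
      (-ContinuousLinearMap.adjoint D') t := by
    simpa [ContinuousLinearMap.star_eq_adjoint] using hinv.star
  refine (hdet.smul (hinv.clm_comp hadj)).congr_deriv ?_
  rw [hid, ContinuousLinearMap.inverse_id, ContinuousLinearMap.coe_id, LinearMap.det_id,
    ContinuousLinearMap.adjoint_id]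
  simp only [ContinuousLinearMap.comp_id, ContinuousLinearMap.id_comp, one_smul]
  abel

end ShapeTransform

section Flow

variable {E : Type*} [NormedAddCommGroup E] [NormedSpace ℝ E] {T : ℝ → E → E}

theorem fderiv_slice_eq (hT : Differentiable ℝ (fun p : ℝ × E => T p.1 p.2)) (p : ℝ × E) :
    fderiv ℝ (T p.1) p.2
      = (fderiv ℝ (fun p : ℝ × E => T p.1 p.2) p).comp (ContinuousLinearMap.inr ℝ ℝ E) :=
  HasFDerivAt.fderiv (f := T p.1)
    ((hT p).hasFDerivAt.comp (f := fun y => (p.1, y)) p.2 (hasFDerivAt_prodMk_right p.1 p.2))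

theorem contDiff_fderiv_slice (hT : ContDiff ℝ 2 (fun p : ℝ × E => T p.1 p.2)) :
    ContDiff ℝ 1 (fun p : ℝ × E => fderiv ℝ (T p.1) p.2) := by
  simp only [fderiv_slice_eq (hT.differentiable two_ne_zero)]
  exact (hT.fderiv_right (m := 1) (by norm_num)).clm_comp contDiff_const

/-- The space derivative of a flow is the identity at time zero, where its time derivative is the
space derivative of the velocity field. -/
theorem hasDerivAt_fderiv_flow_zero {θ : ℝ × E → E} (hT0 : ∀ X, T 0 X = X)
    (hTflow : ∀ t X, HasDerivAt (fun s => T s X) (θ (t, T t X)) t)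
    (hT : ContDiff ℝ 2 (fun p : ℝ × E => T p.1 p.2)) (x : E) :
    HasDerivAt (fun t => fderiv ℝ (T t) x) (fderiv ℝ (fun y => θ (0, y)) x) 0 := by
  set F : ℝ × E → E := fun p => T p.1 p.2 with hF
  have hFd : Differentiable ℝ F := hT.differentiable two_ne_zero
  have hF' : Differentiable ℝ (fderiv ℝ F) :=
    (hT.fderiv_right (m := 1) (by norm_num)).differentiable one_ne_zero
  have hsymm : IsSymmSndFDerivAt ℝ F (0, x) :=
    hT.contDiffAt.isSymmSndFDerivAt (by simp)
  have hθ : (fun y => θ (0, y)) = fun y => fderiv ℝ F (0, y) (1, 0) := by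
    funext y
    have h := (hFd (0, y)).hasFDerivAt.comp_hasDerivAt (0 : ℝ)
      ((hasDerivAt_id (0 : ℝ)).prodMk (hasDerivAt_const (0 : ℝ) y))
    have h2 := (hTflow 0 y).unique h
    rwa [hT0] at h2
  have hcurve : HasDerivAt (fun t : ℝ => fderiv ℝ F (t, x))
      (fderiv ℝ (fderiv ℝ F) (0, x) (1, 0)) 0 :=
    (hF' (0, x)).hasFDerivAt.comp_hasDerivAt (0 : ℝ)
      ((hasDerivAt_id (0 : ℝ)).prodMk (hasDerivAt_const (0 : ℝ) x))
  have hspace : fderiv ℝ (fun y => fderiv ℝ F (0, y) (1, 0)) x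
      = (fderiv ℝ (fderiv ℝ F) (0, x) (1, 0)).comp (ContinuousLinearMap.inr ℝ ℝ E) := by
    have h := ((hF' (0, x)).hasFDerivAt.comp x (hasFDerivAt_prodMk_right (0 : ℝ) x)).clm_apply
      (hasFDerivAt_const ((1 : ℝ), (0 : E)) x)
    refine h.fderiv.trans ?_
    ext v
    simpa using hsymm (0, v) (1, 0)
  have hslice : (fun t => fderiv ℝ (T t) x)
      = fun t => (fderiv ℝ F (t, x)).comp (ContinuousLinearMap.inr ℝ ℝ E) :=
    funext fun t => fderiv_slice_eq hFd (t, x)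
  rw [hslice, hθ, hspace]
  simpa using hcurve.clm_comp (hasDerivAt_const (0 : ℝ) (ContinuousLinearMap.inr ℝ ℝ E))

end Flow

theorem hasDerivAt_setIntegral_flow {d : ℕ} {θ : ℝ × Euc d → Euc d} {T : ℝ → Euc d → Euc d}
    (hT0 : ∀ X, T 0 X = X)
    (hTflow : ∀ t X, HasDerivAt (fun s => T s X) (θ (t, T t X)) t)
    (hT : ContDiff ℝ 2 (fun p : ℝ × Euc d => T p.1 p.2))
    {Ω : Set (Euc d)} (hb : Bornology.IsBounded Ω) (hm : MeasurableSet Ω)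
    {a : Euc d → ℝ} {u v : Euc d → Euc d}
    (ha : Continuous a) (hu : Continuous u) (hv : Continuous v) :
    IntegrableOn (fun x => a x * divTheta0 θ x + ⟪shapeMatrixM θ x (u x), v x⟫) Ω ∧
      HasDerivAt (fun t => ∫ x in Ω,
          (a x * flowJacDet T t x + ⟪shapeMatrixA T t x (u x), v x⟫))
        (∫ x in Ω, (a x * divTheta0 θ x + ⟪shapeMatrixM θ x (u x), v x⟫)) 0 := by
  let D : ℝ × Euc d → Euc d →L[ℝ] Euc d := fun p => fderiv ℝ (T p.1) p.2
  let B : ℝ × Euc d → ℝ × (Euc d →L[ℝ] Euc d) :=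
    fun p => (flowJacDet T p.1 p.2, shapeMatrixA T p.1 p.2)
  let U : Set (ℝ × Euc d) := {p | IsUnit (D p)}
  have hD : ContDiff ℝ 1 D := contDiff_fderiv_slice hT
  have hD0 : ∀ x, D (0, x) = ContinuousLinearMap.id ℝ (Euc d) := fun x => by
    have : T 0 = id := funext hT0
    simp only [D, this, fderiv_id]
  have hU : IsOpen U := Units.isOpen.preimage hD.continuous
  have h0 : ∀ x, ((0 : ℝ), x) ∈ U := fun x => by
    change IsUnit (D (0, x))
    rw [hD0]
    exact isUnit_one
  have hB : ContDiffOn ℝ 1 B U := fun p hp =>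
    ((contDiff_linearMap_det.contDiffAt.comp p hD.contDiffAt).prodMk
      ((contDiffAt_shapeTransform hp).comp p hD.contDiffAt)).contDiffWithinAt
  let B' : ℝ × Euc d → ℝ × (Euc d →L[ℝ] Euc d) := fun p => fderiv ℝ B p (1, 0)
  have hB' : ContinuousOn B' U :=
    (hB.continuousOn_fderiv_of_isOpen hU le_rfl).clm_apply continuousOn_const
  have hBd : ∀ p ∈ U, HasDerivAt (fun t => B (t, p.2)) (B' p) p.1 := fun p hp =>
    ((hB.differentiableOn one_ne_zero).differentiableAt (hU.mem_nhds hp)).hasFDerivAt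
      |>.comp_hasDerivAt p.1 ((hasDerivAt_id p.1).prodMk (hasDerivAt_const p.1 p.2))
  have hB0 : ∀ x, B' (0, x) = (divTheta0 θ x, shapeMatrixM θ x) := by
    intro x
    have hDd := hasDerivAt_fderiv_flow_zero hT0 hTflow hT x
    refine (hBd (0, x) (h0 x)).unique (HasDerivAt.prodMk ?_ ?_)
    · rw [divTheta0, ← fderiv_linearMap_det_id]
      exact HasFDerivAt.comp_hasDerivAt_of_eq (0 : ℝ)
        ((contDiff_linearMap_det (n := 1)).differentiable one_ne_zero _).hasFDerivAt hDd
        (hD0 x).symm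
    · exact hasDerivAt_shapeTransform hDd (hD0 x)
  have hcont : ∀ C : ℝ × Euc d → ℝ × (Euc d →L[ℝ] Euc d), ContinuousOn C U →
      ContinuousOn (fun p : ℝ × Euc d => a p.2 * (C p).1 + ⟪(C p).2 (u p.2), v p.2⟫) U := by
    intro C hC
    fun_prop
  have key := hasDerivAt_setIntegral_of_continuousOn volume hb hm hU h0
    (f := fun t x => a x * (B (t, x)).1 + ⟪(B (t, x)).2 (u x), v x⟫)
    (f' := fun t x => a x * (B' (t, x)).1 + ⟪(B' (t, x)).2 (u x), v x⟫)
    (hcont B hB.continuousOn) (hcont B' hB') (fun p hp => by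
      have h := hBd p hp
      have h1 : HasDerivAt (fun t => (B (t, p.2)).1) (B' p).1 p.1 :=
        (ContinuousLinearMap.fst ℝ ℝ (Euc d →L[ℝ] Euc d)).hasFDerivAt.comp_hasDerivAt p.1 h
      have h2 : HasDerivAt (fun t => (B (t, p.2)).2) (B' p).2 p.1 :=
        (ContinuousLinearMap.snd ℝ ℝ (Euc d →L[ℝ] Euc d)).hasFDerivAt.comp_hasDerivAt p.1 h
      have h3 : HasDerivAt (fun t => (B (t, p.2)).2 (u p.2)) ((B' p).2 (u p.2)) p.1 := by
        simpa using h2.clm_apply (hasDerivAt_const p.1 (u p.2))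
      exact ((h1.const_mul (a p.2)).fun_add
        (h3.inner ℝ (hasDerivAt_const p.1 (v p.2)))).congr_deriv (by simp))
  simpa only [hB0] using key

theorem ContDiff.continuous_gradient {E : Type*} [NormedAddCommGroup E] [InnerProductSpace ℝ E]
    [CompleteSpace E] {f : E → ℝ} (hf : ContDiff ℝ 1 f) : Continuous (gradient f) :=
  (InnerProductSpace.toDual ℝ E).symm.continuous.comp (hf.continuous_fderiv one_ne_zero)

/-- derivative at `t = 0` of the transported Lagrangian `L̃(t)` of the
Poisson–Nernst–Planck constrained shape functional, yielding the Eulerian derivative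
in domain expression. -/
theorem pnp_lagrangian_shape_derivative {d : ℕ}
    (θ : ℝ × Euc d → Euc d)
    (hθ : ContDiff ℝ 1 θ) (hθc : HasCompactSupport θ)
    (T : ℝ → Euc d → Euc d)
    (hT0 : ∀ X, T 0 X = X)
    (hTflow : ∀ t X, HasDerivAt (fun s => T s X) (θ (t, T t X)) t)
    (hT2 : ContDiff ℝ 2 (fun p : ℝ × Euc d => T p.1 p.2))
    (Ω : Set (Euc d)) (hΩb : Bornology.IsBounded Ω) (hΩm : MeasurableSet Ω)
    (N : ℕ) (hN : 1 ≤ N) (ε : ℝ) (hε : 0 < ε) (z : Fin N → ℝ)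
    (c s : Fin N → Euc d → ℝ) (φ ψ : Euc d → ℝ)
    (hc : ∀ i, ContDiff ℝ 1 (c i)) (hcc : ∀ i, HasCompactSupport (c i))
    (hs : ∀ i, ContDiff ℝ 1 (s i)) (hsc : ∀ i, HasCompactSupport (s i))
    (hφ : ContDiff ℝ 1 φ) (hφc : HasCompactSupport φ)
    (hψ : ContDiff ℝ 1 ψ) (hψc : HasCompactSupport ψ) :
    HasDerivAt (fun t =>
        (∑ i, ∫ x in Ω,
          (-(z i) * c i x * flowJacDet T t x
            + ⟪shapeMatrixA T t x (gradient (c i) x), gradient (s i) x⟫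
            + z i * c i x * ⟪shapeMatrixA T t x (gradient φ x), gradient (s i) x⟫))
        + ∫ x in Ω,
          (ε * ⟪shapeMatrixA T t x (gradient φ x), gradient ψ x⟫
            - ∑ i, z i * c i x * ψ x * flowJacDet T t x))
      (∫ x in Ω,
        ((-(∑ i, z i * c i x * ψ x) - ∑ i, z i * c i x) * divTheta0 θ x
          + ∑ i, ⟪shapeMatrixM θ x (gradient (c i) x), gradient (s i) x⟫
          + ∑ i, z i * c i x * ⟪shapeMatrixM θ x (gradient φ x), gradient (s i) x⟫
          + ε * ⟪shapeMatrixM θ x (gradient φ x), gradient ψ x⟫)) 0 := by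
  have hcg := fun i => (hc i).continuous_gradient
  have hsg := fun i => (hs i).continuous_gradient
  have hφg := hφ.continuous_gradient
  have hψg := hψ.continuous_gradient
  have hc0 := fun i => (hc i).continuous
  have hψ0 := hψ.continuous
  have hspecies := fun i => hasDerivAt_setIntegral_flow hT0 hTflow hT2 hΩb hΩm
    (a := fun x => -(z i) * c i x)
    (u := fun x => gradient (c i) x + (z i * c i x) • gradient φ x) (v := gradient (s i))
    (by fun_prop) (by fun_prop) (hsg i)
  have hpotential := hasDerivAt_setIntegral_flow hT0 hTflow hT2 hΩb hΩm
    (a := fun x => -∑ i, z i * c i x * ψ x)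
    (u := fun x => ε • gradient φ x) (v := gradient ψ)
    (by fun_prop) (by fun_prop) hψg
  refine (((HasDerivAt.fun_sum fun i (_ : i ∈ Finset.univ) => (hspecies i).2).fun_add
    hpotential.2).congr_deriv ?_).congr_of_eventuallyEq (.of_forall fun t => ?_)
  · rw [← integral_finsetSum _ fun i _ => (hspecies i).1,
      ← integral_add (integrable_finsetSum _ fun i _ => (hspecies i).1) hpotential.1]
    refine integral_congr_ae (.of_forall fun x => ?_)
    simp only [map_add, map_smul, inner_add_left, real_inner_smul_left, Finset.sum_add_distrib,
      neg_mul, Finset.sum_neg_distrib, ← Finset.sum_mul, sub_mul]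
    ring
  · refine congrArg₂ _ (Finset.sum_congr rfl fun i _ =>
      integral_congr_ae (.of_forall fun x => ?_)) (integral_congr_ae (.of_forall fun x => ?_))
    · simp only [map_add, map_smul, inner_add_left, real_inner_smul_left, add_assoc]
    · simp only [map_smul, real_inner_smul_left, neg_mul, Finset.sum_mul]
      ring
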